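/- arXiv:1202.1771 — 2 statements merged into one kernel-verified Lean document; each statement's English description precedes it below -/
import Mathlib

section
/- For every real q2 with 0 < q2 < 2 one has the closed-form evaluation J(0,q2) = ∫₀^∞ dz / √((z + 4/q2²)·(z² + q2·z + q2²/4)) = 2·√2·q2·artanh(√(8 − q2³) / (2√2)) / √(8 − q2³), where artanh is the real inverse hyperbolic tangent. -/
/-- The self-gravitation potential of the zero-angular-momentum Riemann liquid
ellipsoid problem (coupling constant `α = 1`), with `r = √(q1² + q2²)`. -/
noncomputable def J (q1 q2 : ℝ) : ℝ :=
  ∫ z in Set.Ioi (0 : ℝ),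
    1 / Real.sqrt ((z + 4 / q2 ^ 2) *
      (z ^ 2 + Real.sqrt (q1 ^ 2 + q2 ^ 2) * z + q2 ^ 2 / 4))

/-- The real inverse hyperbolic tangent, `artanh x = (1/2)·log((1+x)/(1−x))`. -/
noncomputable def artanh (x : ℝ) : ℝ := Real.log ((1 + x) / (1 - x)) / 2

/-- A primitive of `z ↦ 1 / √((z + s²)(z + s² - d²)²)`. -/
theorem hasDerivAt_log_sqrt_sub_div_sqrt_add {s d z : ℝ} (hd : 0 < d) (hds : d < s)
    (hz : 0 ≤ z) :
    HasDerivAt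
      (fun x : ℝ => Real.log ((Real.sqrt (x + s ^ 2) - d) / (Real.sqrt (x + s ^ 2) + d)) / d)
      (1 / Real.sqrt ((z + s ^ 2) * (z + (s ^ 2 - d ^ 2)) ^ 2)) z := by
  have hs : 0 < s := hd.trans hds
  have hpos : 0 < z + s ^ 2 := by positivity
  set u := Real.sqrt (z + s ^ 2) with hu
  have hu2 : u ^ 2 = z + s ^ 2 := Real.sq_sqrt hpos.le
  have hus : s ≤ u := Real.le_sqrt_of_sq_le (by linarith)
  have hu0 : 0 < u := hs.trans_le hus
  have hm : 0 < u - d := by linarith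
  have hp : 0 < u + d := by linarith
  have hroot : HasDerivAt (fun x : ℝ => Real.sqrt (x + s ^ 2)) (1 / (2 * u)) z :=
    ((hasDerivAt_id z).add_const (s ^ 2)).sqrt hpos.ne'
  have hlog := (((hroot.sub_const d).div (hroot.add_const d) hp.ne').log
    (div_pos hm hp).ne').div_const d
  refine hlog.congr_deriv ?_
  have hz' : z + (s ^ 2 - d ^ 2) = (u - d) * (u + d) := by linear_combination -hu2
  rw [Real.sqrt_mul hpos.le, ← hu, hz', Real.sqrt_sq (by positivity)]
  simp only [Pi.div_apply, ← hu]
  field_simp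
  ring

theorem tendsto_log_sqrt_sub_div_sqrt_add (s d : ℝ) :
    Filter.Tendsto
      (fun x : ℝ => Real.log ((Real.sqrt (x + s ^ 2) - d) / (Real.sqrt (x + s ^ 2) + d)) / d)
      Filter.atTop (nhds 0) := by
  have hroot : Filter.Tendsto (fun x : ℝ => Real.sqrt (x + s ^ 2) + d)
      Filter.atTop Filter.atTop :=
    Filter.tendsto_atTop_add_const_right _ _
      (Real.tendsto_sqrt_atTop.comp (Filter.tendsto_atTop_add_const_right _ _ Filter.tendsto_id))
  have hratio : Filter.Tendsto
      (fun x : ℝ => (Real.sqrt (x + s ^ 2) - d) / (Real.sqrt (x + s ^ 2) + d))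
      Filter.atTop (nhds 1) := by
    have h := (hroot.const_div_atTop (2 * d)).const_sub 1
    rw [sub_zero] at h
    refine h.congr' ?_
    filter_upwards [hroot.eventually_gt_atTop 0] with x hx
    field_simp
    ring
  simpa using (hratio.log one_ne_zero).div_const d

theorem integral_Ioi_one_div_sqrt_mul_sq {s d : ℝ} (hd : 0 < d) (hds : d < s) :
    ∫ z in Set.Ioi (0 : ℝ), 1 / Real.sqrt ((z + s ^ 2) * (z + (s ^ 2 - d ^ 2)) ^ 2) =
      2 * artanh (d / s) / d := by
  have hs : 0 < s := hd.trans hds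
  have hm : 0 < s - d := sub_pos.2 hds
  rw [MeasureTheory.integral_Ioi_of_hasDerivAt_of_nonneg'
    (fun z hz => hasDerivAt_log_sqrt_sub_div_sqrt_add hd hds hz)
    (fun z _ => by positivity) (tendsto_log_sqrt_sub_div_sqrt_add s d),
    zero_add, Real.sqrt_sq hs.le, artanh]
  have harg : (1 + d / s) / (1 - d / s) = ((s - d) / (s + d))⁻¹ := by
    have : 1 - d / s = (s - d) / s := by field_simp
    rw [this]
    field_simp
  rw [harg, Real.log_inv]
  ring

/-- For every real `q2` with `0 < q2 < 2` one has the closed-form evaluation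
`J(0,q2) = 2√2·q2·artanh(√(8 − q2³)/(2√2)) / √(8 − q2³)`. -/
theorem J_eq_closed_form_of_lt_two (q2 : ℝ) (hq2 : 0 < q2) (hq2' : q2 < 2) :
    J 0 q2 =
      2 * Real.sqrt 2 * q2 * artanh (Real.sqrt (8 - q2 ^ 3) / (2 * Real.sqrt 2)) /
        Real.sqrt (8 - q2 ^ 3) := by
  have hcube : 0 < 8 - q2 ^ 3 := by
    have := pow_lt_pow_left₀ hq2' hq2.le three_ne_zero
    linarith
  set D := Real.sqrt (8 - q2 ^ 3)
  have hD : 0 < D := Real.sqrt_pos.2 hcube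
  have hD2 : D ^ 2 = 8 - q2 ^ 3 := Real.sq_sqrt hcube.le
  have h2 : 0 < Real.sqrt 2 := by positivity
  have h22 : Real.sqrt 2 ^ 2 = 2 := Real.sq_sqrt zero_le_two
  have hs : (2 / q2) ^ 2 = 4 / q2 ^ 2 := by rw [div_pow]; norm_num
  have hb : (2 / q2) ^ 2 - (D / (Real.sqrt 2 * q2)) ^ 2 = q2 / 2 := by
    rw [div_pow, div_pow, mul_pow, hD2, h22]
    field_simp
    ring
  have hlt : D / (Real.sqrt 2 * q2) < 2 / q2 := by
    refine lt_of_pow_lt_pow_left₀ 2 (by positivity) ?_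
    linarith
  have hint := integral_Ioi_one_div_sqrt_mul_sq (by positivity) hlt
  have hJ : J 0 q2 = 2 * artanh (D / (Real.sqrt 2 * q2) / (2 / q2)) / (D / (Real.sqrt 2 * q2)) := by
    rw [← hint, hb, hs, J]
    congr! 5 with z
    rw [zero_pow two_ne_zero, zero_add, Real.sqrt_sq hq2.le]
    ring
  have harg : D / (Real.sqrt 2 * q2) / (2 / q2) = D / (2 * Real.sqrt 2) := by
    field_simp
  rw [hJ, harg]
  field_simp
end

section
/- For every real x > 2, the derivative at x of the function q2 ↦ J(0,q2) vanishes if and only if arccos(2√2 / x^{3/2}) = 6√2·√(x³ − 8) / (x³ + 16). -/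
theorem cube_sub_eight_pos {x : ℝ} (hx : 2 < x) : 0 < x ^ 3 - 8 := by
  have := pow_lt_pow_left₀ hx zero_le_two three_ne_zero
  linarith

/-- The restriction of the potential to the axis `q1 = 0`, in closed form. -/
theorem J_zero_eq {q : ℝ} (hq : 2 < q) :
    J 0 q = 2 * √2 * q / √(q ^ 3 - 8) * Real.arctan (√(q ^ 3 - 8) / (2 * √2)) := by
  have hq0 : 0 < q := by linarith
  have hs : 0 < q ^ 3 - 8 := cube_sub_eight_pos hq
  set s := √(q ^ 3 - 8)
  have hs0 : 0 < s := Real.sqrt_pos.2 hs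
  have hs2 : s ^ 2 = q ^ 3 - 8 := Real.sq_sqrt hs.le
  set w := √(2 : ℝ)
  have hw0 : 0 < w := Real.sqrt_pos.2 two_pos
  have hw2 : w ^ 2 = 2 := Real.sq_sqrt two_pos.le
  set c := s / (w * q) with hc_def
  have hc0 : 0 < c := by positivity
  have hc2 : c ^ 2 = q / 2 - 4 / q ^ 2 := by
    rw [hc_def, div_pow, mul_pow, hs2, hw2]
    field_simp
    ring
  have h_integrand : ∀ z ∈ Set.Ioi (0 : ℝ),
      1 / √((z + 4 / q ^ 2) * (z ^ 2 + √(0 ^ 2 + q ^ 2) * z + q ^ 2 / 4)) =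
        1 / (√(z + 4 / q ^ 2) * (z + q / 2)) := by
    intro z hz
    have hz : 0 < z := hz
    have hr : √(0 ^ 2 + q ^ 2) = q := by
      rw [zero_pow two_ne_zero, zero_add, Real.sqrt_sq hq0.le]
    rw [hr, show z ^ 2 + q * z + q ^ 2 / 4 = (z + q / 2) ^ 2 by ring,
      Real.sqrt_mul (by positivity), Real.sqrt_sq (by positivity)]
  have h_deriv : ∀ z ∈ Set.Ici (0 : ℝ),
      HasDerivAt (fun z => 2 / c * Real.arctan (√(z + 4 / q ^ 2) / c))
        (1 / (√(z + 4 / q ^ 2) * (z + q / 2))) z := by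
    intro z hz
    have hz : 0 ≤ z := hz
    have hza : 0 < z + 4 / q ^ 2 := by positivity
    have h := ((((hasDerivAt_id z).add_const (4 / q ^ 2)).sqrt hza.ne').div_const c).arctan.const_mul
      (2 / c)
    refine h.congr_deriv ?_
    have hu0 := Real.sqrt_pos.2 hza
    simp only [id]
    rw [div_pow, Real.sq_sqrt hza.le,
      show 1 + (z + 4 / q ^ 2) / c ^ 2 = (z + q / 2) / c ^ 2 by
        field_simp
        rw [hc2]
        field_simp
        ring]
    field_simp
  have h_lim : Filter.Tendsto (fun z => 2 / c * Real.arctan (√(z + 4 / q ^ 2) / c))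
      Filter.atTop (nhds (2 / c * (Real.pi / 2))) := by
    refine Filter.Tendsto.const_mul _ ?_
    refine (tendsto_nhds_of_tendsto_nhdsWithin Real.tendsto_arctan_atTop).comp ?_
    exact (Real.tendsto_sqrt_atTop.comp
      (Filter.tendsto_atTop_add_const_right _ _ Filter.tendsto_id)).atTop_div_const hc0
  have h_sqrt : √(0 + 4 / q ^ 2) = 2 / q := by
    rw [zero_add, show (4 : ℝ) / q ^ 2 = (2 / q) ^ 2 by ring, Real.sqrt_sq (by positivity)]
  have h_inv : 2 / q / c = (s / (2 * w))⁻¹ := by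
    rw [hc_def]
    field_simp
  have h_coeff : 2 / c = 2 * w * q / s := by
    rw [hc_def]
    field_simp
  rw [J, MeasureTheory.setIntegral_congr_fun measurableSet_Ioi h_integrand,
    MeasureTheory.integral_Ioi_of_hasDerivAt_of_nonneg' h_deriv
      (fun z hz => by have hz : 0 < z := hz; positivity) h_lim,
    h_sqrt, h_inv, Real.arctan_inv_of_pos (by positivity), h_coeff]
  ring

/-- The derivative of the closed form of the potential on the axis `q1 = 0`. -/
theorem hasDerivAt_J_zero {x : ℝ} (hx : 2 < x) :
    HasDerivAt (fun q => J 0 q)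
      (√2 * (x ^ 3 + 16) / √(x ^ 3 - 8) ^ 3 *
        (6 * √2 * √(x ^ 3 - 8) / (x ^ 3 + 16) - Real.arctan (√(x ^ 3 - 8) / (2 * √2)))) x := by
  have hx0 : 0 < x := by linarith
  have hs : 0 < x ^ 3 - 8 := cube_sub_eight_pos hx
  have h_sqrt := ((hasDerivAt_pow 3 x).sub_const 8).sqrt hs.ne'
  have hs0 : 0 < √(x ^ 3 - 8) := Real.sqrt_pos.2 hs
  have h := (((hasDerivAt_id x).const_mul (2 * √2)).div h_sqrt hs0.ne').mul
    (h_sqrt.div_const (2 * √2)).arctan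
  refine HasDerivAt.congr_of_eventuallyEq (h.congr_deriv ?_)
    ((eventually_gt_nhds hx).mono fun q hq => J_zero_eq hq)
  have hs2 : √(x ^ 3 - 8) ^ 2 = x ^ 3 - 8 := Real.sq_sqrt hs.le
  simp only [id, Pi.div_apply]
  generalize √(x ^ 3 - 8) = s at hs0 hs2 ⊢
  generalize Real.arctan (s / (2 * √2)) = A
  have hw0 : 0 < √(2 : ℝ) := Real.sqrt_pos.2 two_pos
  have hw2 : √(2 : ℝ) ^ 2 = 2 := Real.sq_sqrt two_pos.le
  generalize √(2 : ℝ) = w at hw0 hw2 ⊢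
  have h_one_add : 1 + (s / (2 * w)) ^ 2 = x ^ 3 / 8 := by
    rw [div_pow, mul_pow, hs2, hw2]
    ring
  have hx3 : x ^ 3 = s ^ 2 + 8 := by linarith
  rw [h_one_add]
  norm_num
  field_simp
  rw [hx3]
  ring_nf
  rw [hw2]
  ring

theorem arccos_eq_arctan_sqrt_cube {x : ℝ} (hx : 2 ≤ x) :
    Real.arccos (2 * √2 / x ^ ((3 : ℝ) / 2)) = Real.arctan (√(x ^ 3 - 8) / (2 * √2)) := by
  have hx0 : 0 ≤ x := by linarith
  have hs : 0 ≤ x ^ 3 - 8 := by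
    have := pow_le_pow_left₀ zero_le_two hx 3
    linarith
  have h_rpow : x ^ ((3 : ℝ) / 2) = √(x ^ 3) := by
    rw [Real.sqrt_eq_rpow, ← Real.rpow_natCast, ← Real.rpow_mul hx0]
    norm_num
  have h_sqrt_eight : √8 = 2 * √2 := by
    rw [show (8 : ℝ) = 2 ^ 2 * 2 by norm_num, Real.sqrt_mul (by norm_num),
      Real.sqrt_sq zero_le_two]
  rw [Real.arctan_eq_arccos (by positivity), h_rpow, ← h_sqrt_eight, div_pow,
    Real.sq_sqrt hs, Real.sq_sqrt (by norm_num), show 1 + (x ^ 3 - 8) / 8 = x ^ 3 / 8 by ring,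
    Real.sqrt_div (by positivity), inv_div]

/-- For every real `x > 2`, the derivative at `x` of `q2 ↦ J(0,q2)` vanishes if and
only if `arccos(2√2/x^(3/2)) = 6√2·√(x³ − 8)/(x³ + 16)`. -/
theorem critical_point_iff (x : ℝ) (hx : 2 < x) :
    deriv (fun q2 : ℝ => J 0 q2) x = 0 ↔
      Real.arccos (2 * Real.sqrt 2 / x ^ ((3 : ℝ) / 2)) =
        6 * Real.sqrt 2 * Real.sqrt (x ^ 3 - 8) / (x ^ 3 + 16) := by
  have hs : 0 < x ^ 3 - 8 := cube_sub_eight_pos hx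
  have h_coeff : √2 * (x ^ 3 + 16) / √(x ^ 3 - 8) ^ 3 ≠ 0 := by
    have := Real.sqrt_pos.2 hs
    positivity
  rw [(hasDerivAt_J_zero hx).deriv, arccos_eq_arctan_sqrt_cube hx.le,
    mul_eq_zero_iff_left h_coeff, sub_eq_zero, eq_comm]
end
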